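/- arXiv:2008.13319 — 7 statements merged into one kernel-verified Lean document; each statement's English description precedes it below -/
import Mathlib

section
/- (Bellman equation of variance for factored Markov chains, Theorem 1.) For every step h ∈ {1,…,H} and every state s ∈ S, the variance of the return satisfies ω²_h(s) = Σ_{s'∈S} P(s'|s) ω²_{h+1}(s') + Σ_{i=1}^n σ²_{P,i,h}(s) + (1/m²) Σ_{i=1}^m σ²_{R,i}(s), where σ²_{P,i,h}(s) = σ²_i(P(·|s), V_{h+1}) is the i-th factored conditional variance of V_{h+1} under the product transition pmf P(·|s), and ω²_{H+1} ≡ 0. -/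
open Finset

variable {n : ℕ}

/-- `p` is a probability mass function on a finite type. -/
def IsPmf {X : Type} [Fintype X] (p : X → ℝ) : Prop :=
  (∀ x, 0 ≤ p x) ∧ ∑ x, p x = 1

/-- L1 distance between two real-valued functions on a finite type. -/
def l1dist {X : Type} [Fintype X] (p q : X → ℝ) : ℝ :=
  ∑ x, |p x - q x|

/-- Merge a choice of coordinates below `i`, the coordinate at `i`, and
coordinates above `i` into a full state. -/
def merge (S : Fin n → Type) (i : Fin n)
    (a : ∀ j : {j : Fin n // j < i}, S j.1) (b : S i)
    (c : ∀ j : {j : Fin n // i < j}, S j.1) : ∀ j, S j := fun j =>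
  if h : j < i then a ⟨j, h⟩
  else if h' : i < j then c ⟨j, h'⟩
  else cast (congrArg S (le_antisymm (not_lt.mp h') (not_lt.mp h))).symm b

/-- `G S p V i a b` : expectation of `V` over the coordinates above `i`
(drawn independently from `p j`), given values `a` below `i` and `b` at `i`. -/
def G (S : Fin n → Type) [∀ i, Fintype (S i)] (p : ∀ i, S i → ℝ)
    (V : (∀ i, S i) → ℝ) (i : Fin n)
    (a : ∀ j : {j : Fin n // j < i}, S j.1) (b : S i) : ℝ :=
  ∑ c : ∀ j : {j : Fin n // i < j}, S j.1,
    (∏ j, p j.1 (c j)) * V (merge S i a b c)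

/-- The `i`-th factored conditional variance
`σ²_i(p, V) = E_{s[1:i-1]}[ Var_{s[i]}( E_{s[i+1:n]}[V(s)] ) ]`. -/
def facVar (S : Fin n → Type) [∀ i, Fintype (S i)] (p : ∀ i, S i → ℝ)
    (V : (∀ i, S i) → ℝ) (i : Fin n) : ℝ :=
  ∑ a : ∀ j : {j : Fin n // j < i}, S j.1,
    (∏ j, p j.1 (a j)) *
      ((∑ b : S i, p i b * (G S p V i a b) ^ 2)
        - (∑ b : S i, p i b * G S p V i a b) ^ 2)

open MeasureTheory ProbabilityTheory

section Merge

variable (S : Fin n → Type) (i : Fin n) (a : ∀ j : {j : Fin n // j < i}, S j.1) (b : S i)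
  (c : ∀ j : {j : Fin n // i < j}, S j.1)

lemma merge_lt (j : {j : Fin n // j < i}) : merge S i a b c j.1 = a j := by
  simp [merge, j.2]

lemma merge_self : merge S i a b c i = b := by
  simp [merge]

lemma merge_gt (j : {j : Fin n // i < j}) : merge S i a b c j.1 = c j := by
  simp [merge, j.2, not_lt.mpr j.2.le]

lemma merge_restrict (s : ∀ j, S j) :
    merge S i (fun j => s j.1) (s i) (fun j => s j.1) = s := by
  funext j
  rcases lt_trichotomy j i with h | h | h
  · exact merge_lt S i _ _ _ ⟨j, h⟩
  · subst h
    exact merge_self S j _ _ _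
  · exact merge_gt S i _ _ _ ⟨j, h⟩

/-- `merge` as an equivalence between splittings of a state at `i` and states. -/
def mergeEquiv :
    ((∀ j : {j : Fin n // j < i}, S j.1) × S i × (∀ j : {j : Fin n // i < j}, S j.1)) ≃
      (∀ j, S j) where
  toFun x := merge S i x.1 x.2.1 x.2.2
  invFun s := (fun j => s j.1, s i, fun j => s j.1)
  left_inv x := by
    ext j
    · exact merge_lt S i _ _ _ j
    · exact merge_self S i _ _ _
    · exact merge_gt S i _ _ _ j
  right_inv s := merge_restrict S i s

lemma sum_eq_sum_merge [∀ i, Fintype (S i)] (f : (∀ j, S j) → ℝ) :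
    ∑ s, f s = ∑ a, ∑ b, ∑ c, f (merge S i a b c) := by
  rw [← (mergeEquiv S i).sum_comp f]
  simp only [Fintype.sum_prod_type]
  rfl

lemma prod_split (f : Fin n → ℝ) :
    ∏ j, f j = (∏ j : {j : Fin n // j < i}, f j.1) * f i * ∏ j : {j : Fin n // i < j}, f j.1 := by
  rw [← Finset.prod_subtype (Iio i) (fun _ => mem_Iio) f,
    ← Finset.prod_subtype (Ioi i) (fun _ => mem_Ioi) f, mul_comm (∏ j ∈ Iio i, f j),
    ← Finset.prod_insert (by simp), Finset.Iio_insert, ← Finset.prod_union]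
  · congr 1
    ext j
    simp [le_or_gt]
  · rw [Finset.disjoint_left]
    intro j
    simp

lemma prod_merge (p : ∀ i, S i → ℝ) :
    ∏ j, p j (merge S i a b c j) = (∏ j, p j.1 (a j)) * p i b * ∏ j, p j.1 (c j) := by
  rw [prod_split i]
  simp only [merge_lt, merge_gt, merge_self]

end Merge

section FactoredVariance

variable (S : Fin n → Type) [∀ i, Fintype (S i)] (p : ∀ i, S i → ℝ) (V : (∀ i, S i) → ℝ)

/-- Conditional expectation of `V` under `⊗p` given the coordinates below `k` of `s`. -/
def prefixMean (k : ℕ) (s : ∀ i, S i) : ℝ :=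
  ∑ t : ∀ i, S i, (∏ j, p j (t j)) * V (fun j => if j.1 < k then s j else t j)

/-- Second moment of the conditional expectation of `V` given the coordinates below `k`. -/
def prefixSecondMoment (k : ℕ) : ℝ :=
  ∑ s, (∏ j, p j (s j)) * prefixMean S p V k s ^ 2

lemma prefixMean_zero (s : ∀ i, S i) :
    prefixMean S p V 0 s = ∑ t, (∏ j, p j (t j)) * V t := by
  simp [prefixMean]

variable {p}

lemma sum_prod_subtype_eq_one (hp : ∀ i, ∑ x, p i x = 1) (q : Fin n → Prop) [DecidablePred q] :
    ∑ a : ∀ j : {j : Fin n // q j}, S j.1, ∏ j, p j.1 (a j) = 1 := by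
  classical
  rw [← Fintype.prod_sum fun (j : {j // q j}) x => p j.1 x]
  simp [hp]

lemma sum_prod_eq_one (hp : ∀ i, ∑ x, p i x = 1) : ∑ s : ∀ j, S j, ∏ j, p j (s j) = 1 := by
  classical
  rw [← Fintype.prod_sum]
  simp [hp]

lemma prefixMean_top (hp : ∀ i, ∑ x, p i x = 1) (s : ∀ i, S i) : prefixMean S p V n s = V s := by
  simp [prefixMean, ← Finset.sum_mul, sum_prod_eq_one S hp]

lemma prefixMean_succ (hp : ∀ i, ∑ x, p i x = 1) (i : Fin n)
    (a : ∀ j : {j : Fin n // j < i}, S j.1) (b : S i)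
    (c : ∀ j : {j : Fin n // i < j}, S j.1) :
    prefixMean S p V (i + 1) (merge S i a b c) = G S p V i a b := by
  have key (a' b' c') : (fun j : Fin n => if j.1 < i + 1 then merge S i a b c j
      else merge S i a' b' c' j) = merge S i a b c' := by
    funext j
    simp only [merge]
    split_ifs <;> first | rfl | omega
  simp only [prefixMean, sum_eq_sum_merge S i, key, prod_merge, mul_assoc, ← Finset.mul_sum]
  simp only [← Finset.sum_mul, hp, sum_prod_subtype_eq_one S hp, one_mul, G]

lemma prefixMean_castSucc (hp : ∀ i, ∑ x, p i x = 1) (i : Fin n)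
    (a : ∀ j : {j : Fin n // j < i}, S j.1) (b : S i)
    (c : ∀ j : {j : Fin n // i < j}, S j.1) :
    prefixMean S p V i (merge S i a b c) = ∑ b', p i b' * G S p V i a b' := by
  have key (a' b' c') : (fun j : Fin n => if j.1 < i then merge S i a b c j
      else merge S i a' b' c' j) = merge S i a b' c' := by
    funext j
    simp only [merge]
    split_ifs <;> first | rfl | omega
  simp only [prefixMean, sum_eq_sum_merge S i, key, prod_merge, mul_assoc, ← Finset.mul_sum]
  simp only [← Finset.sum_mul, sum_prod_subtype_eq_one S hp, one_mul, G]

lemma facVar_eq_sub (hp : ∀ i, ∑ x, p i x = 1) (i : Fin n) :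
    facVar S p V i = prefixSecondMoment S p V (i + 1) - prefixSecondMoment S p V i := by
  simp only [prefixSecondMoment, sum_eq_sum_merge S i, prefixMean_succ S V hp,
    prefixMean_castSucc S V hp, prod_merge, facVar]
  rw [← Finset.sum_sub_distrib]
  refine Finset.sum_congr rfl fun a _ => ?_
  simp only [mul_assoc, mul_comm (∏ j : {j : Fin n // i < j}, _), ← Finset.mul_sum]
  simp only [sum_prod_subtype_eq_one S hp, mul_one, ← Finset.sum_mul, hp, one_mul]
  ring

/-- The factored conditional variances sum to the variance of `V` under `⊗p`. -/
lemma sum_facVar (hp : ∀ i, ∑ x, p i x = 1) :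
    ∑ i, facVar S p V i =
      ∑ s, (∏ j, p j (s j)) * V s ^ 2 - (∑ s, (∏ j, p j (s j)) * V s) ^ 2 := by
  simp only [facVar_eq_sub S V hp]
  rw [Fin.sum_univ_eq_sum_range
    (fun k => prefixSecondMoment S p V (k + 1) - prefixSecondMoment S p V k),
    Finset.sum_range_sub]
  simp only [prefixSecondMoment, prefixMean_top S V hp, prefixMean_zero]
  rw [← Finset.sum_mul, sum_prod_eq_one S hp, one_mul]

end FactoredVariance

section Mixture

variable {ι : Type*} [Fintype ι] {w : ι → ℝ} {μ : ι → Measure ℝ}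

lemma isProbabilityMeasure_mixture [∀ i, IsProbabilityMeasure (μ i)] (hw : ∀ i, 0 ≤ w i)
    (hw1 : ∑ i, w i = 1) : IsProbabilityMeasure (∑ i, ENNReal.ofReal (w i) • μ i) := by
  constructor
  simp [← ENNReal.ofReal_sum_of_nonneg fun i _ => hw i, hw1]

lemma integrable_mixture {f : ℝ → ℝ} (hf : ∀ i, Integrable f (μ i)) :
    Integrable f (∑ i, ENNReal.ofReal (w i) • μ i) :=
  integrable_finsetSum_measure.2 fun i _ => (hf i).smul_measure ENNReal.ofReal_ne_top

lemma integral_mixture (hw : ∀ i, 0 ≤ w i) {f : ℝ → ℝ} (hf : ∀ i, Integrable f (μ i)) :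
    ∫ x, f x ∂(∑ i, ENNReal.ofReal (w i) • μ i) = ∑ i, w i * ∫ x, f x ∂μ i := by
  rw [integral_finsetSum_measure fun i _ => (hf i).smul_measure ENNReal.ofReal_ne_top]
  simp [integral_smul_measure, ENNReal.toReal_ofReal (hw _)]

lemma memLp_two_mixture (hμ : ∀ i, MemLp id 2 (μ i)) :
    MemLp id 2 (∑ i, ENNReal.ofReal (w i) • μ i) := by
  rw [memLp_two_iff_integrable_sq (by fun_prop)]
  exact integrable_mixture fun i => (hμ i).integrable_sq

/-- Law of total variance for a finite mixture. -/
lemma variance_mixture [∀ i, IsProbabilityMeasure (μ i)] (hw : ∀ i, 0 ≤ w i)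
    (hw1 : ∑ i, w i = 1) (hμ : ∀ i, MemLp id 2 (μ i)) :
    variance id (∑ i, ENNReal.ofReal (w i) • μ i) =
      ∑ i, w i * variance id (μ i)
        + (∑ i, w i * (∫ x, x ∂μ i) ^ 2 - (∑ i, w i * ∫ x, x ∂μ i) ^ 2) := by
  have := isProbabilityMeasure_mixture (μ := μ) hw hw1
  rw [variance_eq_sub (memLp_two_mixture hμ)]
  simp only [variance_eq_sub (hμ _), Pi.pow_apply, id]
  rw [integral_mixture (f := fun x => x ^ 2) hw fun i => (hμ i).integrable_sq,
    integral_mixture (f := fun x => x) hw fun i => (hμ i).integrable one_le_two]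
  simp only [mul_sub, Finset.sum_sub_distrib]
  ring!

end Mixture

section AverageReward

variable {m : ℕ} {R : Fin m → Measure ℝ} [∀ i, IsProbabilityMeasure (R i)]

lemma memLp_id_of_measure_Icc {μ : Measure ℝ} [IsProbabilityMeasure μ]
    (h : μ (Set.Icc (0 : ℝ) 1) = 1) : MemLp id 2 μ :=
  memLp_of_bounded (a := 0) (b := 1) ((mem_ae_iff_prob_eq_one measurableSet_Icc).2 h)
    aestronglyMeasurable_id 2

lemma memLp_average (hR : ∀ i, MemLp id 2 (R i)) :
    MemLp (fun r : Fin m → ℝ => (1 / (m : ℝ)) * ∑ i, r i) 2 (Measure.pi R) :=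
  (memLp_finsetSum _ fun i _ =>
    (hR i).comp_measurePreserving (measurePreserving_eval R i)).const_mul _

lemma variance_average (hR : ∀ i, MemLp id 2 (R i)) :
    variance (fun r : Fin m → ℝ => (1 / (m : ℝ)) * ∑ i, r i) (Measure.pi R) =
      (1 / (m : ℝ) ^ 2) * ∑ i, variance id (R i) := by
  rw [variance_const_mul, ← variance_sum_pi hR, one_div_pow]
  congr 2
  ext r
  simp

end AverageReward

lemma memLp_add_prod {μ ν : Measure ℝ} [IsProbabilityMeasure μ] [IsProbabilityMeasure ν]
    (hμ : MemLp id 2 μ) (hν : MemLp id 2 ν) :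
    MemLp id 2 (Measure.map (fun x : ℝ × ℝ => x.1 + x.2) (μ.prod ν)) := by
  rw [memLp_map_measure_iff aestronglyMeasurable_id (by fun_prop)]
  exact (hμ.comp_fst ν).add (hν.comp_snd μ)

/-- **Bellman equation of variance for factored Markov chains (Theorem 1).**
`ν h s` is the law of the total reward collected from step `h` through step `H`
starting at state `s`; its variance `ω²_h(s)` satisfies
`ω²_h(s) = Σ_{s'} P(s'|s) ω²_{h+1}(s') + Σ_i σ²_{P,i,h}(s) + (1/m²) Σ_i σ²_{R,i}(s)`. -/
theorem bellman_equation_of_variance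
    (n m H : ℕ) (hn : 1 ≤ n) (hm : 1 ≤ m) (hH : 1 ≤ H)
    (S : Fin n → Type) [∀ i, Fintype (S i)] [∀ i, Nonempty (S i)]
    -- factored transition kernel: `P s i` is a pmf on `S i`
    (P : (∀ i, S i) → ∀ i, S i → ℝ)
    (hP : ∀ s i, IsPmf (P s i))
    -- factored rewards: `R i s` is a Borel probability measure supported in `[0,1]`
    (R : Fin m → (∀ i, S i) → Measure ℝ)
    [∀ i s, IsProbabilityMeasure (R i s)]
    (hRsupp : ∀ i s, (R i s) (Set.Icc (0 : ℝ) 1) = 1)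
    -- `ν h s` : the law of the total reward `J_{h:H}` starting from `s_h = s`,
    -- defined by backward recursion
    (ν : ℕ → (∀ i, S i) → Measure ℝ)
    (hνtop : ∀ s, ν (H + 1) s = Measure.dirac 0)
    (hνrec : ∀ h, 1 ≤ h → h ≤ H → ∀ s,
      ν h s = Measure.map (fun x : ℝ × ℝ => x.1 + x.2)
        ((Measure.map (fun r : Fin m → ℝ => (1 / (m : ℝ)) * ∑ i, r i)
              (Measure.pi fun i => R i s)).prod
          (∑ s' : ∀ i, S i, ENNReal.ofReal (∏ i, P s i (s' i)) • ν (h + 1) s'))) :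
    ∀ h, 1 ≤ h → h ≤ H → ∀ s,
      variance id (ν h s)
        = (∑ s' : ∀ i, S i, (∏ i, P s i (s' i)) * variance id (ν (h + 1) s'))
          + (∑ i, facVar S (P s) (fun s' => ∫ x, x ∂(ν (h + 1) s')) i)
          + (1 / (m : ℝ) ^ 2) * ∑ i, variance id (R i s) := by
  have hw (s s' : ∀ i, S i) : 0 ≤ ∏ i, P s i (s' i) :=
    Finset.prod_nonneg fun i _ => (hP s i).1 _
  have hw1 (s : ∀ i, S i) : ∑ s' : ∀ i, S i, ∏ i, P s i (s' i) = 1 :=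
    sum_prod_eq_one S fun i => (hP s i).2
  have hR i s : MemLp id 2 (R i s) := memLp_id_of_measure_Icc (hRsupp i s)
  have hρ (s : ∀ i, S i) : IsProbabilityMeasure (Measure.map
      (fun r : Fin m → ℝ => (1 / (m : ℝ)) * ∑ i, r i) (Measure.pi fun i => R i s)) :=
    Measure.isProbabilityMeasure_map (by fun_prop)
  have hρ2 (s : ∀ i, S i) : MemLp id 2 (Measure.map
      (fun r : Fin m → ℝ => (1 / (m : ℝ)) * ∑ i, r i) (Measure.pi fun i => R i s)) := by
    rw [memLp_map_measure_iff aestronglyMeasurable_id (by fun_prop)]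
    exact memLp_average fun i => hR i s
  have hν : ∀ h, 1 ≤ h → h ≤ H + 1 → ∀ s, IsProbabilityMeasure (ν h s) ∧ MemLp id 2 (ν h s) := by
    intro h h1 hh
    induction hh using Nat.decreasingInduction with
    | self =>
      intro s
      rw [hνtop]
      exact ⟨inferInstance, memLp_id_of_measure_Icc (by simp)⟩
    | of_succ h hh ih =>
      intro s
      have hprob s' : IsProbabilityMeasure (ν (h + 1) s') := (ih (by omega) s').1
      have := isProbabilityMeasure_mixture (μ := ν (h + 1)) (hw s) (hw1 s)
      rw [hνrec h h1 (by omega) s]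
      exact ⟨Measure.isProbabilityMeasure_map (by fun_prop),
        memLp_add_prod (hρ2 s) (memLp_two_mixture fun s' => (ih (by omega) s').2)⟩
  intro h h1 hhH s
  have hprob s' : IsProbabilityMeasure (ν (h + 1) s') := (hν _ (by omega) (by omega) s').1
  have hmem s' : MemLp id 2 (ν (h + 1) s') := (hν _ (by omega) (by omega) s').2
  have := isProbabilityMeasure_mixture (μ := ν (h + 1)) (hw s) (hw1 s)
  rw [hνrec h h1 hhH, variance_id_map (by fun_prop)]
  refine (variance_add_prod (X := id) (Y := id) (hρ2 s) (memLp_two_mixture hmem)).trans ?_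
  rw [variance_id_map (by fun_prop), variance_average fun i => hR i s,
    variance_mixture (hw s) (hw1 s) hmem, sum_facVar S _ fun i => (hP s i).2]
  ring
end

section
/- (Estimation error decomposition, Lemma 1 / second inequality of the decomposition lemma.) Let p_1,…,p_n and q_1,…,q_n be pmfs on S_1,…,S_n, let V : S → ℝ, and write ‖V‖_∞ = max_{s∈S} |V(s)|. Then | Σ_{s∈S} ( Π_{i=1}^n q_i(s_i) − Π_{i=1}^n p_i(s_i) ) V(s) | ≤ Σ_{i=1}^n | Σ_{s∈S} ( q_i(s_i) − p_i(s_i) ) ( Π_{j≠i} p_j(s_j) ) V(s) | + ‖V‖_∞ · Σ_{i=1}^n Σ_{j≠i} ‖q_i − p_i‖₁ · ‖q_j − p_j‖₁. -/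
open Finset

variable {n : ℕ}

section ProductPmf

variable {ι : Type*} [DecidableEq ι] {S : ι → Type}

/-- Replacing the factors in `insert a T` rather than in `T` changes only the factor at `a`. -/
theorem prod_piecewise_insert (q p : ∀ i, S i → ℝ) {T U : Finset ι} {a : ι} (haT : a ∉ T)
    (haU : a ∈ U) (s : ∀ i, S i) :
    ∏ j ∈ U, (insert a T).piecewise q p j (s j)
      = ∏ j ∈ U, T.piecewise q p j (s j)
        + (q a (s a) - p a (s a)) * ∏ j ∈ U.erase a, T.piecewise q p j (s j) := by
  have h : ∏ j ∈ U.erase a, (insert a T).piecewise q p j (s j)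
      = ∏ j ∈ U.erase a, T.piecewise q p j (s j) :=
    prod_congr rfl fun j hj => by rw [piecewise_insert_of_ne _ _ _ (ne_of_mem_erase hj)]
  rw [← mul_prod_erase U _ haU, ← mul_prod_erase U (fun j => T.piecewise q p j (s j)) haU, h,
    piecewise_insert_self, piecewise_eq_of_notMem _ _ _ haT]
  ring

theorem IsPmf.piecewise [∀ i, Fintype (S i)] {p q : ∀ i, S i → ℝ}
    (hq : ∀ i, IsPmf (q i)) (hp : ∀ i, IsPmf (p i)) (T : Finset ι) (i : ι) :
    IsPmf (T.piecewise q p i) :=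
  T.piecewise_cases q p IsPmf (hq i) (hp i)

variable [Fintype ι] [∀ i, Fintype (S i)]

/-- The L1 norm of a tensor product with pmf factors outside two given coordinates. -/
theorem sum_abs_mul_mul_prod_erase_erase {r : ∀ i, S i → ℝ} (hr : ∀ i, IsPmf (r i))
    (d : ∀ i, S i → ℝ) {a k : ι} (hak : k ≠ a) :
    ∑ s : ∀ i, S i, |d a (s a) * (d k (s k) * ∏ j ∈ (univ.erase a).erase k, r j (s j))|
      = (∑ x, |d a x|) * ∑ x, |d k x| := by
  have hk : k ∈ univ.erase a := by simp [hak]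
  let f : ∀ i, S i → ℝ := fun i x => if i = a ∨ i = k then |d i x| else r i x
  have hfa : f a = fun x => |d a x| := by simp [f]
  have hfk : f k = fun x => |d k x| := by simp [f]
  have hf : ∀ j ∈ (univ.erase a).erase k, f j = r j := by
    intro j hj
    simp only [mem_erase, mem_univ, and_true] at hj
    simp [f, hj.1, hj.2]
  calc
    _ = ∑ s : ∀ i, S i, ∏ i, f i (s i) := by
      refine sum_congr rfl fun s _ => ?_
      rw [← mul_prod_erase univ _ (mem_univ a), ← mul_prod_erase _ _ hk, hfa, hfk,
        abs_mul, abs_mul, abs_of_nonneg (prod_nonneg fun j _ => (hr j).1 (s j)),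
        prod_congr rfl fun j hj => congrFun (hf j hj) (s j)]
    _ = ∏ i, ∑ x, f i x := (Fintype.prod_sum f).symm
    _ = _ := by
      rw [← mul_prod_erase univ _ (mem_univ a), ← mul_prod_erase _ _ hk, hfa, hfk,
        prod_eq_one fun j hj => by rw [hf j hj, (hr j).2], mul_one]

variable {p q : ∀ i, S i → ℝ}

/-- First-order bound: replacing the factors in `T`, with the factor at `a` a fixed difference. -/
theorem sum_abs_sub_mul_prod_piecewise_sub_le (hp : ∀ i, IsPmf (p i)) (hq : ∀ i, IsPmf (q i))
    {a : ι} {T : Finset ι} (haT : a ∉ T) :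
    ∑ s : ∀ i, S i, |(q a (s a) - p a (s a)) *
        (∏ j ∈ univ.erase a, T.piecewise q p j (s j) - ∏ j ∈ univ.erase a, p j (s j))|
      ≤ ∑ k ∈ T, l1dist (q a) (p a) * l1dist (q k) (p k) := by
  induction T using Finset.induction_on with
  | empty => simp
  | insert k T hkT ih =>
    obtain ⟨hak, haT⟩ : a ≠ k ∧ a ∉ T := by simpa using haT
    have hk : k ∈ univ.erase a := by simp [hak.symm]
    have hsum : ∑ s : ∀ i, S i, |(q a (s a) - p a (s a)) * ((q k (s k) - p k (s k)) *
        ∏ j ∈ (univ.erase a).erase k, T.piecewise q p j (s j))|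
        = l1dist (q a) (p a) * l1dist (q k) (p k) :=
      sum_abs_mul_mul_prod_erase_erase (IsPmf.piecewise hq hp T)
        (fun i x => q i x - p i x) hak.symm
    rw [sum_insert hkT, ← hsum]
    refine le_trans ?_ (add_le_add_right (ih haT) _)
    rw [← sum_add_distrib]
    refine sum_le_sum fun s _ => ?_
    rw [prod_piecewise_insert q p hkT hk]
    refine le_trans (le_of_eq ?_) (abs_add_le _ _)
    congr 1
    ring

/-- Second-order bound: replacing the factors in `T`, up to the first-order terms. -/
theorem sum_abs_prod_piecewise_sub_sub_le (hp : ∀ i, IsPmf (p i)) (hq : ∀ i, IsPmf (q i))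
    (T : Finset ι) :
    ∑ s : ∀ i, S i, |∏ j, T.piecewise q p j (s j) - ∏ j, p j (s j)
        - ∑ i ∈ T, (q i (s i) - p i (s i)) * ∏ j ∈ univ.erase i, p j (s j)|
      ≤ ∑ i ∈ T, ∑ j ∈ univ.erase i, l1dist (q i) (p i) * l1dist (q j) (p j) := by
  have hl : ∀ i, 0 ≤ l1dist (q i) (p i) := fun i => sum_nonneg fun _ _ => abs_nonneg _
  induction T using Finset.induction_on with
  | empty => simp
  | insert a T haT ih =>
    have hT : T ⊆ univ.erase a := fun k hk =>
      mem_erase.2 ⟨ne_of_mem_of_not_mem hk haT, mem_univ k⟩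
    have hstep := (sum_abs_sub_mul_prod_piecewise_sub_le hp hq haT).trans
      (sum_le_sum_of_subset_of_nonneg hT fun k _ _ => mul_nonneg (hl a) (hl k))
    rw [sum_insert haT]
    refine le_trans ?_ (add_le_add hstep ih)
    rw [← sum_add_distrib]
    refine sum_le_sum fun s _ => ?_
    rw [prod_piecewise_insert q p haT (mem_univ a), sum_insert haT]
    refine le_trans (le_of_eq ?_) (abs_add_le _ _)
    congr 1
    ring

end ProductPmf

/-- **Estimation error decomposition (Lemma 1).** The error of the product
distribution on a value function decomposes, up to second-order cross terms,
into an additive form over the factors. -/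
theorem estimation_error_decomposition
    (hn : 1 ≤ n)
    (S : Fin n → Type) [∀ i, Fintype (S i)] [∀ i, Nonempty (S i)]
    (p q : ∀ i, S i → ℝ)
    (hp : ∀ i, IsPmf (p i)) (hq : ∀ i, IsPmf (q i))
    (V : (∀ i, S i) → ℝ) :
    |∑ s : ∀ i, S i, ((∏ i, q i (s i)) - ∏ i, p i (s i)) * V s|
      ≤ (∑ i, |∑ s : ∀ i, S i,
            (q i (s i) - p i (s i)) * (∏ j ∈ Finset.univ.erase i, p j (s j)) * V s|)
        + (Finset.univ.sup' Finset.univ_nonempty fun s : ∀ i, S i => |V s|)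
          * ∑ i, ∑ j ∈ Finset.univ.erase i, l1dist (q i) (p i) * l1dist (q j) (p j) := by
  set M := univ.sup' univ_nonempty fun s : ∀ i, S i => |V s|
  have hV : ∀ s, |V s| ≤ M := fun s => le_sup' (fun s => |V s|) (mem_univ s)
  have hM : 0 ≤ M := (abs_nonneg _).trans (hV (Classical.arbitrary _))
  have hR := sum_abs_prod_piecewise_sub_sub_le hp hq univ
  simp only [piecewise_univ] at hR
  have hsplit : ∑ s : ∀ i, S i, ((∏ i, q i (s i)) - ∏ i, p i (s i)) * V s
      = (∑ i, ∑ s : ∀ i, S i,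
          (q i (s i) - p i (s i)) * (∏ j ∈ univ.erase i, p j (s j)) * V s)
        + ∑ s : ∀ i, S i, (∏ i, q i (s i) - ∏ i, p i (s i)
          - ∑ i, (q i (s i) - p i (s i)) * ∏ j ∈ univ.erase i, p j (s j)) * V s := by
    rw [sum_comm, ← sum_add_distrib]
    refine sum_congr rfl fun s _ => ?_
    rw [← sum_mul]
    ring
  rw [hsplit]
  refine (abs_add_le _ _).trans (add_le_add (abs_sum_le_sum_abs _ _) ?_)
  refine le_trans ?_ (mul_le_mul_of_nonneg_left hR hM)
  rw [mul_sum]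
  refine (abs_sum_le_sum_abs _ _).trans (sum_le_sum fun s _ => ?_)
  rw [abs_mul, mul_comm]
  exact mul_le_mul_of_nonneg_right (hV s) (abs_nonneg _)
end

section
/- (Stability of factored conditional variance under perturbation of the factors; deterministic core of the lemma on the variance difference between the empirical and the true transition.) Let p_1,…,p_n and q_1,…,q_n be pmfs on S_1,…,S_n, let H ≥ 0, and let V : S → ℝ satisfy 0 ≤ V(s) ≤ H for all s ∈ S. Then for every i ∈ {1,…,n}: | σ²_i(p, V) − σ²_i(q, V) | ≤ 4H² Σ_{j=1}^n ‖p_j − q_j‖₁. -/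
open Finset

variable {n : ℕ}

/-- The expectation under a pmf of a function with values in `[0, M]` lies in `[0, M]`. -/
lemma IsPmf.expect_mem {X : Type} [Fintype X] {p f : X → ℝ} {M : ℝ} (hp : IsPmf p)
    (hf : ∀ x, 0 ≤ f x ∧ f x ≤ M) : 0 ≤ ∑ x, p x * f x ∧ ∑ x, p x * f x ≤ M := by
  refine ⟨sum_nonneg fun x _ => mul_nonneg (hp.1 x) (hf x).1, ?_⟩
  calc ∑ x, p x * f x ≤ ∑ x, p x * M :=
        sum_le_sum fun x _ => mul_le_mul_of_nonneg_left (hf x).2 (hp.1 x)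
    _ = M := by rw [← sum_mul, hp.2, one_mul]

/-- Expectations are stable under simultaneous perturbation of the pmf and the integrand. -/
lemma abs_expect_sub_expect_le {X : Type} [Fintype X] {p q f g : X → ℝ} {M D : ℝ}
    (hq : IsPmf q) (hf : ∀ x, |f x| ≤ M) (hfg : ∀ x, |f x - g x| ≤ D) :
    |∑ x, p x * f x - ∑ x, q x * g x| ≤ M * l1dist p q + D := by
  calc |∑ x, p x * f x - ∑ x, q x * g x|
      = |∑ x, ((p x - q x) * f x + q x * (f x - g x))| := by
        rw [← sum_sub_distrib]
        congr 1
        exact sum_congr rfl fun x _ => by ring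
    _ ≤ ∑ x, |(p x - q x) * f x + q x * (f x - g x)| := abs_sum_le_sum_abs _ _
    _ ≤ ∑ x, (M * |p x - q x| + q x * D) := by
        refine sum_le_sum fun x _ => (abs_add_le _ _).trans (add_le_add ?_ ?_)
        · rw [abs_mul, mul_comm]
          exact mul_le_mul_of_nonneg_right (hf x) (abs_nonneg _)
        · rw [abs_mul, abs_of_nonneg (hq.1 x)]
          exact mul_le_mul_of_nonneg_left (hfg x) (hq.1 x)
    _ = M * l1dist p q + D := by
        rw [sum_add_distrib, ← mul_sum, ← sum_mul, hq.2, one_mul, l1dist]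

lemma abs_sq_sub_sq_le {x y M D : ℝ} (hx : 0 ≤ x ∧ x ≤ M) (hy : 0 ≤ y ∧ y ≤ M)
    (h : |x - y| ≤ D) : |x ^ 2 - y ^ 2| ≤ 2 * M * D := by
  rw [sq_sub_sq, abs_mul, abs_of_nonneg (add_nonneg hx.1 hy.1)]
  exact mul_le_mul (by linarith [hx.2, hy.2]) h (abs_nonneg _) (by linarith [hx.1, hx.2])

section Product

variable {ι : Type} [Fintype ι] [DecidableEq ι] {S : ι → Type} [∀ j, Fintype (S j)]

lemma IsPmf.prod {p : ∀ j, S j → ℝ} (hp : ∀ j, IsPmf (p j)) :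
    IsPmf fun c : ∀ j, S j => ∏ j, p j (c j) := by
  refine ⟨fun c => prod_nonneg fun j _ => (hp j).1 _, ?_⟩
  rw [← Fintype.prod_sum]
  exact prod_eq_one fun j _ => (hp j).2

/-- Replacing a single factor of a product pmf moves it by the L1 distance of the factors. -/
lemma l1dist_prod_update (r : ∀ j, S j → ℝ) (hr : ∀ j, IsPmf (r j)) (a : ι) (u : S a → ℝ) :
    l1dist (fun c : ∀ j, S j => ∏ j, Function.update r a u j (c j))
      (fun c => ∏ j, r j (c j)) = l1dist u (r a) := by
  have key : ∀ c : ∀ j, S j,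
      |∏ j, Function.update r a u j (c j) - ∏ j, r j (c j)| =
        ∏ j, Function.update r a (fun x => |u x - r a x|) j (c j) := by
    intro c
    have off : ∀ v : S a → ℝ, ∏ j, Function.update r a v j (c j) =
        v (c a) * ∏ j ∈ univ.erase a, r j (c j) := by
      intro v
      rw [← mul_prod_erase univ _ (mem_univ a), Function.update_self]
      congr 1
      exact prod_congr rfl fun j hj => by rw [Function.update_of_ne (ne_of_mem_erase hj)]
    rw [off, off, ← mul_prod_erase univ (fun j => r j (c j)) (mem_univ a), ← sub_mul, abs_mul,
      abs_of_nonneg (prod_nonneg fun j _ => (hr j).1 _)]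
  unfold l1dist
  rw [sum_congr rfl fun c _ => key c, ← Fintype.prod_sum,
    ← mul_prod_erase univ _ (mem_univ a), Function.update_self]
  rw [prod_eq_one, mul_one]
  intro j hj
  rw [Function.update_of_ne (ne_of_mem_erase hj), (hr j).2]

lemma l1dist_triangle {X : Type} [Fintype X] (p q r : X → ℝ) :
    l1dist p r ≤ l1dist p q + l1dist q r := by
  unfold l1dist
  rw [← sum_add_distrib]
  exact sum_le_sum fun x _ => abs_sub_le _ _ _

/-- The L1 distance of product pmfs is at most the sum of the L1 distances of the factors. -/
lemma l1dist_prod_le {p q : ∀ j, S j → ℝ} (hp : ∀ j, IsPmf (p j)) (hq : ∀ j, IsPmf (q j)) :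
    l1dist (fun c : ∀ j, S j => ∏ j, p j (c j)) (fun c => ∏ j, q j (c j)) ≤
      ∑ j, l1dist (p j) (q j) := by
  have hybrid : ∀ s : Finset ι,
      l1dist (fun c : ∀ j, S j => ∏ j, s.piecewise p q j (c j)) (fun c => ∏ j, q j (c j)) ≤
        ∑ j ∈ s, l1dist (p j) (q j) := by
    intro s
    induction s using Finset.induction_on with
    | empty => simp [l1dist]
    | insert a s ha ih =>
      have hr : ∀ j, IsPmf (s.piecewise p q j) := fun j => by
        by_cases hj : j ∈ s <;> simp [hj, hp j, hq j]
      have step := l1dist_prod_update (s.piecewise p q) hr a (p a)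
      rw [piecewise_eq_of_notMem s p q ha] at step
      rw [sum_insert ha, piecewise_insert, ← step]
      exact (l1dist_triangle _ _ _).trans (add_le_add_right ih _)
  simpa using hybrid univ

end Product

lemma sum_eq_sum_lt_add_sum_gt (i : Fin n) (f : Fin n → ℝ) :
    ∑ j, f j = ∑ j : {j : Fin n // j < i}, f j + f i + ∑ j : {j : Fin n // i < j}, f j := by
  rw [← sum_subtype (univ.filter (· < i)) (by simp) f,
    ← sum_subtype (univ.filter (i < ·)) (by simp) f, sum_filter, sum_filter,
    ← Fintype.sum_ite_eq i f, ← sum_add_distrib, ← sum_add_distrib]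
  refine sum_congr rfl fun j _ => ?_
  rcases lt_trichotomy j i with h | h | h
  · simp [h, h.ne', h.not_gt]
  · simp [h]
  · simp [h, h.ne, h.not_gt]

/-- Stability of the variance of a `[0, H]`-valued function under simultaneous perturbation of the
pmf and the function. -/
lemma abs_variance_sub_variance_le {X : Type} [Fintype X] {p q f g : X → ℝ} {H D : ℝ}
    (hp : IsPmf p) (hq : IsPmf q) (hf : ∀ x, 0 ≤ f x ∧ f x ≤ H) (hg : ∀ x, 0 ≤ g x ∧ g x ≤ H)
    (hfg : ∀ x, |f x - g x| ≤ D) :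
    |(∑ x, p x * f x ^ 2 - (∑ x, p x * f x) ^ 2) -
        (∑ x, q x * g x ^ 2 - (∑ x, q x * g x) ^ 2)| ≤
      3 * H ^ 2 * l1dist p q + 4 * H * D := by
  have second : |∑ x, p x * f x ^ 2 - ∑ x, q x * g x ^ 2| ≤ H ^ 2 * l1dist p q + 2 * H * D :=
    abs_expect_sub_expect_le hq
      (fun x => by
        rw [abs_of_nonneg (sq_nonneg _)]
        exact pow_le_pow_left₀ (hf x).1 (hf x).2 2)
      (fun x => abs_sq_sub_sq_le (hf x) (hg x) (hfg x))
  have first : |∑ x, p x * f x - ∑ x, q x * g x| ≤ H * l1dist p q + D :=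
    abs_expect_sub_expect_le hq (fun x => by rw [abs_of_nonneg (hf x).1]; exact (hf x).2) hfg
  have mean := abs_sq_sub_sq_le (hp.expect_mem hf) (hq.expect_mem hg) first
  rw [abs_le] at *
  constructor <;> linarith [second.1, second.2, mean.1, mean.2]

/-- **Stability of the factored conditional variance under perturbation of the
factors** (deterministic core of the empirical-vs-true variance lemma). -/
theorem facVar_stability
    (hn : 1 ≤ n)
    (S : Fin n → Type) [∀ i, Fintype (S i)] [∀ i, Nonempty (S i)]
    (p q : ∀ i, S i → ℝ)
    (hp : ∀ i, IsPmf (p i)) (hq : ∀ i, IsPmf (q i))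
    (H : ℝ) (hH : 0 ≤ H)
    (V : (∀ i, S i) → ℝ) (hV : ∀ s, 0 ≤ V s ∧ V s ≤ H)
    (i : Fin n) :
    |facVar S p V i - facVar S q V i| ≤ 4 * H ^ 2 * ∑ j, l1dist (p j) (q j) := by
  have hH2 : 0 ≤ H ^ 2 := sq_nonneg H
  have hG : ∀ r : ∀ i, S i → ℝ, (∀ i, IsPmf (r i)) → ∀ a b,
      0 ≤ G S r V i a b ∧ G S r V i a b ≤ H := fun r hr a b =>
    (IsPmf.prod fun j : {j : Fin n // i < j} => hr j.1).expect_mem fun c => hV _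
  have hGd : ∀ a b, |G S p V i a b - G S q V i a b| ≤
      H * ∑ j : {j : Fin n // i < j}, l1dist (p j) (q j) := by
    intro a b
    have h := abs_expect_sub_expect_le (p := fun c => ∏ j : {j : Fin n // i < j}, p j.1 (c j))
      (IsPmf.prod fun j : {j : Fin n // i < j} => hq j.1) (M := H) (D := 0)
      (f := fun c => V (merge S i a b c)) (g := fun c => V (merge S i a b c))
      (fun c => by rw [abs_of_nonneg (hV _).1]; exact (hV _).2) (fun c => by simp)
    rw [add_zero] at h
    exact h.trans (mul_le_mul_of_nonneg_left
      (l1dist_prod_le (fun j : {j : Fin n // i < j} => hp j.1) fun j => hq j.1) hH)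
  have hW : ∀ a, |(∑ b : S i, p i b * (G S p V i a b) ^ 2)
      - (∑ b : S i, p i b * G S p V i a b) ^ 2| ≤ H ^ 2 := by
    intro a
    have h1 := (hp i).expect_mem (hG p hp a)
    have h2 := (hp i).expect_mem (f := fun b => (G S p V i a b) ^ 2) (M := H ^ 2)
      fun b => ⟨sq_nonneg _, pow_le_pow_left₀ (hG p hp a b).1 (hG p hp a b).2 2⟩
    have h3 := pow_le_pow_left₀ h1.1 h1.2 2
    rw [abs_le]
    constructor <;> linarith [h2.1, h2.2, sq_nonneg (∑ b : S i, p i b * G S p V i a b)]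
  have main := abs_expect_sub_expect_le
    (p := fun a => ∏ j : {j : Fin n // j < i}, p j.1 (a j))
    (IsPmf.prod fun j : {j : Fin n // j < i} => hq j.1) hW fun a =>
      abs_variance_sub_variance_le (hp i) (hq i) (hG p hp a) (hG q hq a) (hGd a)
  have low := mul_le_mul_of_nonneg_left
    (l1dist_prod_le (fun j : {j : Fin n // j < i} => hp j.1) fun j => hq j.1) hH2
  have nonneg : ∀ j, 0 ≤ l1dist (p j) (q j) := fun j => sum_nonneg fun x _ => abs_nonneg _
  have lowSum : 0 ≤ H ^ 2 * ∑ j : {j : Fin n // j < i}, l1dist (p j) (q j) :=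
    mul_nonneg hH2 (sum_nonneg fun j _ => nonneg j)
  have mid := mul_nonneg hH2 (nonneg i)
  rw [sum_eq_sum_lt_add_sum_gt i fun j => l1dist (p j) (q j)]
  refine main.trans ?_
  linarith
end

section
/- (Surrogate-variance bound used for optimism; deterministic core of the lemma bounding the true variance by the optimistic empirical variance plus a correction.) Let q_1,…,q_n be pmfs on S_1,…,S_n and let V_, V*, V̄ : S → ℝ satisfy V_(s) ≤ V*(s) ≤ V̄(s) for all s ∈ S. Then for every i ∈ {1,…,n}: σ²_i(q, V*) ≤ 2 σ²_i(q, V̄) + 2 u_i, where u_i = Σ_{(s_1,…,s_i)} ( Π_{j≤i} q_j(s_j) ) · ( Σ_{(s_{i+1},…,s_n)} ( Π_{j>i} q_j(s_j) ) ( V̄(s) − V_(s) ) )², i.e. u_i = E_{s[1:i]}[ ( E_{s[i+1:n]}[ (V̄ − V_)(s) ] )² ] under the product pmf ⊗q. -/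
open Finset

variable {n : ℕ}

/-- Jensen's inequality for the square under a pmf. -/
theorem IsPmf.sq_sum_le {X : Type} [Fintype X] {p : X → ℝ} (hp : IsPmf p) (f : X → ℝ) :
    (∑ x, p x * f x) ^ 2 ≤ ∑ x, p x * f x ^ 2 := by
  have h := Finset.sum_sq_le_sum_mul_sum_of_sq_le_mul Finset.univ
    (r := fun x => p x * f x) (f := p) (g := fun x => p x * f x ^ 2)
    (fun x _ => hp.1 x) (fun x _ => mul_nonneg (hp.1 x) (sq_nonneg _))
    (fun x _ => (by ring : _ = _).le)
  rwa [hp.2, one_mul] at h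

/-- If `f ≤ g`, the variance of `f` is at most twice the variance of `g` plus twice the second
moment of any function dominating `g - f`. -/
theorem IsPmf.variance_le {X : Type} [Fintype X] {p : X → ℝ} (hp : IsPmf p) {f g w : X → ℝ}
    (hfg : ∀ x, f x ≤ g x) (hgw : ∀ x, g x - f x ≤ w x) :
    (∑ x, p x * f x ^ 2) - (∑ x, p x * f x) ^ 2
      ≤ 2 * ((∑ x, p x * g x ^ 2) - (∑ x, p x * g x) ^ 2) + 2 * ∑ x, p x * w x ^ 2 := by
  have hw : ∑ x, p x * (g x - f x) ^ 2 ≤ ∑ x, p x * w x ^ 2 :=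
    Finset.sum_le_sum fun x _ => mul_le_mul_of_nonneg_left
      (pow_le_pow_left₀ (sub_nonneg.2 (hfg x)) (hgw x) 2) (hp.1 x)
  have hvar := hp.sq_sum_le fun x => 2 * g x - f x
  have hmean : ∑ x, p x * (2 * g x - f x) = 2 * (∑ x, p x * g x) - ∑ x, p x * f x := by
    rw [Finset.mul_sum, ← Finset.sum_sub_distrib]
    exact Finset.sum_congr rfl fun x _ => by ring
  have hsq : (∑ x, p x * f x ^ 2) + ∑ x, p x * (2 * g x - f x) ^ 2
      = 2 * (∑ x, p x * g x ^ 2) + 2 * ∑ x, p x * (g x - f x) ^ 2 := by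
    simp only [Finset.mul_sum, ← Finset.sum_add_distrib]
    exact Finset.sum_congr rfl fun x _ => by ring
  rw [hmean] at hvar
  nlinarith [sq_nonneg ((∑ x, p x * g x) - ∑ x, p x * f x)]

theorem G_mono (S : Fin n → Type) [∀ i, Fintype (S i)] {p : ∀ i, S i → ℝ}
    (hp : ∀ i x, 0 ≤ p i x) {V W : (∀ i, S i) → ℝ} (hVW : ∀ s, V s ≤ W s) (i : Fin n)
    (a : ∀ j : {j : Fin n // j < i}, S j.1) (b : S i) : G S p V i a b ≤ G S p W i a b :=
  Finset.sum_le_sum fun _ _ => mul_le_mul_of_nonneg_left (hVW _)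
    (Finset.prod_nonneg fun _ _ => hp _ _)

theorem G_sub (S : Fin n → Type) [∀ i, Fintype (S i)] (p : ∀ i, S i → ℝ)
    (V W : (∀ i, S i) → ℝ) (i : Fin n)
    (a : ∀ j : {j : Fin n // j < i}, S j.1) (b : S i) :
    G S p (fun s => V s - W s) i a b = G S p V i a b - G S p W i a b := by
  simp only [G, mul_sub, Finset.sum_sub_distrib]

/-- **Surrogate-variance bound used for optimism** (deterministic core of the
lemma bounding the true variance by the optimistic empirical variance plus a
correction term `uᵢ`). -/
theorem facVar_surrogate_bound
    (hn : 1 ≤ n)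
    (S : Fin n → Type) [∀ i, Fintype (S i)] [∀ i, Nonempty (S i)]
    (q : ∀ i, S i → ℝ) (hq : ∀ i, IsPmf (q i))
    (Vund Vstar Vbar : (∀ i, S i) → ℝ)
    (hord : ∀ s, Vund s ≤ Vstar s ∧ Vstar s ≤ Vbar s)
    (i : Fin n) :
    facVar S q Vstar i
      ≤ 2 * facVar S q Vbar i
        + 2 * ∑ a : ∀ j : {j : Fin n // j < i}, S j.1, ∑ b : S i,
            (∏ j, q j.1 (a j)) * q i b
              * (G S q (fun s => Vbar s - Vund s) i a b) ^ 2 := by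
  have hq0 : ∀ i x, 0 ≤ q i x := fun i => (hq i).1
  simp only [facVar, Finset.mul_sum (s := Finset.univ (α := ∀ j : {j : Fin n // j < i}, S j.1)),
    ← Finset.sum_add_distrib]
  refine Finset.sum_le_sum fun a _ => ?_
  have hvar := (hq i).variance_le (f := G S q Vstar i a) (g := G S q Vbar i a)
    (w := G S q (fun s => Vbar s - Vund s) i a)
    (G_mono S hq0 (fun s => (hord s).2) i a)
    (fun b => by
      rw [G_sub]
      exact sub_le_sub_left (G_mono S hq0 (fun s => (hord s).1) i a b) _)
  refine (mul_le_mul_of_nonneg_left hvar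
    (Finset.prod_nonneg fun j _ => hq0 j.1 (a j))).trans_eq ?_
  simp only [mul_assoc, ← Finset.mul_sum]
  ring
end

section
/- (Optimism of bonus-augmented clipped value iteration; deterministic core of the paper's optimism lemma.) Let R̂ : 𝒮 × 𝒜 → ℝ, let P̂(·|s,a) be a pmf on 𝒮 for each (s,a), and let b : 𝒮 × 𝒜 → ℝ. Define V̄_{H+1} ≡ 0 and, backward for h = H,…,1, Q̄_h(s,a) = min{ H, R̂(s,a) + b(s,a) + Σ_{s'} P̂(s'|s,a) V̄_{h+1}(s') } and V̄_h(s) = max_{a∈𝒜} Q̄_h(s,a). If for every h ∈ {1,…,H} and every pair (s,a): R̄(s,a) − R̂(s,a) + Σ_{s'} ( P(s'|s,a) − P̂(s'|s,a) ) V*_{h+1}(s') ≤ b(s,a), then V̄_h(s) ≥ V*_h(s) for all h ∈ {1,…,H+1} and all s ∈ 𝒮. -/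
open Finset

theorem IsPmf.sum_mul_le {X : Type} [Fintype X] {p : X → ℝ} (hp : IsPmf p) {f : X → ℝ} {c : ℝ}
    (hf : ∀ x, f x ≤ c) : ∑ x, p x * f x ≤ c :=
  calc ∑ x, p x * f x ≤ ∑ x, p x * c :=
        Finset.sum_le_sum fun x _ => mul_le_mul_of_nonneg_left (hf x) (hp.1 x)
    _ = c := by rw [← Finset.sum_mul, hp.2, one_mul]

/-- **Optimism of bonus-augmented clipped value iteration** (deterministic core
of the optimism lemma): if the bonus dominates the one-step estimation error on
the optimal value function, then the clipped optimistic values dominate the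
optimal values. -/
theorem optimism_of_clipped_value_iteration
    (S A : Type) [Fintype S] [Nonempty S] [Fintype A] [Nonempty A]
    (H : ℕ) (hH : 1 ≤ H)
    (Rbar : S → A → ℝ) (hR : ∀ s a, 0 ≤ Rbar s a ∧ Rbar s a ≤ 1)
    (P : S → A → S → ℝ) (hP : ∀ s a, IsPmf (P s a))
    -- optimal value functions
    (Vstar : ℕ → S → ℝ)
    (hVstarTop : ∀ s, Vstar (H + 1) s = 0)
    (hVstarRec : ∀ h, 1 ≤ h → h ≤ H → ∀ s,
      Vstar h s = Finset.univ.sup' Finset.univ_nonempty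
        (fun a => Rbar s a + ∑ s', P s a s' * Vstar (h + 1) s'))
    -- estimated model and bonus
    (Rhat : S → A → ℝ)
    (Phat : S → A → S → ℝ) (hPhat : ∀ s a, IsPmf (Phat s a))
    (b : S → A → ℝ)
    -- bonus-augmented clipped value iteration
    (Qbar : ℕ → S → A → ℝ) (Vbar : ℕ → S → ℝ)
    (hVbarTop : ∀ s, Vbar (H + 1) s = 0)
    (hQbar : ∀ h, 1 ≤ h → h ≤ H → ∀ s a,
      Qbar h s a = min (H : ℝ)
        (Rhat s a + b s a + ∑ s', Phat s a s' * Vbar (h + 1) s'))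
    (hVbar : ∀ h, 1 ≤ h → h ≤ H → ∀ s,
      Vbar h s = Finset.univ.sup' Finset.univ_nonempty (fun a => Qbar h s a))
    -- the bonus dominates the one-step estimation error on `V*`
    (hbonus : ∀ h, 1 ≤ h → h ≤ H → ∀ s a,
      Rbar s a - Rhat s a + ∑ s', (P s a s' - Phat s a s') * Vstar (h + 1) s'
        ≤ b s a) :
    ∀ h, 1 ≤ h → h ≤ H + 1 → ∀ s, Vstar h s ≤ Vbar h s := by
  have value_le : ∀ k h, h + k = H + 1 → 1 ≤ h → ∀ s, Vstar h s ≤ k := by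
    intro k
    induction k with
    | zero =>
      rintro h rfl _ s
      simp [hVstarTop s]
    | succ k ih =>
      intro h hk h1 s
      rw [hVstarRec h h1 (by omega) s]
      refine Finset.sup'_le _ _ fun a _ => ?_
      have := (hP s a).sum_mul_le (ih (h + 1) (by omega) (by omega))
      push_cast
      linarith [(hR s a).2]
  intro h h1 hH1
  induction hH1 using Nat.decreasingInduction with
  | self => exact fun s => (hVstarTop s).trans_le (hVbarTop s).ge
  | of_succ h hlt ih =>
    intro s
    have hle : h ≤ H := by omega
    have hV : Vstar h s ≤ H :=
      (value_le (H + 1 - h) h (by omega) h1 s).trans (by exact_mod_cast (by omega))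
    rw [hVstarRec h h1 hle s] at hV ⊢
    rw [hVbar h h1 hle s]
    refine Finset.sup'_mono_fun fun a ha => ?_
    rw [hQbar h h1 hle s a]
    refine le_min ((Finset.le_sup' _ ha).trans hV) ?_
    have hb := hbonus h h1 hle s a
    simp only [sub_mul, Finset.sum_sub_distrib] at hb
    have hmono : ∑ s', Phat s a s' * Vstar (h + 1) s' ≤ ∑ s', Phat s a s' * Vbar (h + 1) s' :=
      Finset.sum_le_sum fun s' _ =>
        mul_le_mul_of_nonneg_left (ih (by omega) s') ((hPhat s a).1 s')
    linarith
end

section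
/- (Pessimism of bonus-penalized clipped value iteration; deterministic core of the paper's pessimism lemma.) Let π = (π_1,…,π_H) with π_h : 𝒮 → 𝒜 be any deterministic policy, let R̂ : 𝒮 × 𝒜 → ℝ, let P̂(·|s,a) be a pmf on 𝒮 for each (s,a), and let b : 𝒮 × 𝒜 → ℝ. Define V__{H+1} ≡ 0 and, backward for h = H,…,1, V__h(s) = max{ 0, R̂(s,π_h(s)) − b(s,π_h(s)) + Σ_{s'} P̂(s'|s,π_h(s)) V__{h+1}(s') }. If for every h ∈ {1,…,H} and every pair (s,a): R̂(s,a) − R̄(s,a) + Σ_{s'} ( P̂(s'|s,a) − P(s'|s,a) ) V*_{h+1}(s') ≤ b(s,a), then V__h(s) ≤ V*_h(s) for all h ∈ {1,…,H+1} and all s ∈ 𝒮. -/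
open Finset

/-- **Pessimism of bonus-penalized clipped value iteration** (deterministic core
of the pessimism lemma): if the bonus dominates the one-step estimation error on
the optimal value function, then the clipped pessimistic values along any
deterministic policy are dominated by the optimal values. -/
theorem pessimism_of_clipped_value_iteration
    (S A : Type) [Fintype S] [Nonempty S] [Fintype A] [Nonempty A]
    (H : ℕ) (hH : 1 ≤ H)
    (Rbar : S → A → ℝ) (hR : ∀ s a, 0 ≤ Rbar s a ∧ Rbar s a ≤ 1)
    (P : S → A → S → ℝ) (hP : ∀ s a, IsPmf (P s a))
    -- optimal value functions
    (Vstar : ℕ → S → ℝ)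
    (hVstarTop : ∀ s, Vstar (H + 1) s = 0)
    (hVstarRec : ∀ h, 1 ≤ h → h ≤ H → ∀ s,
      Vstar h s = Finset.univ.sup' Finset.univ_nonempty
        (fun a => Rbar s a + ∑ s', P s a s' * Vstar (h + 1) s'))
    -- a deterministic policy, an estimated model, and a bonus
    (π : ℕ → S → A)
    (Rhat : S → A → ℝ)
    (Phat : S → A → S → ℝ) (hPhat : ∀ s a, IsPmf (Phat s a))
    (b : S → A → ℝ)
    -- bonus-penalized clipped value iteration along `π`
    (Vund : ℕ → S → ℝ)
    (hVundTop : ∀ s, Vund (H + 1) s = 0)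
    (hVundRec : ∀ h, 1 ≤ h → h ≤ H → ∀ s,
      Vund h s = max 0
        (Rhat s (π h s) - b s (π h s)
          + ∑ s', Phat s (π h s) s' * Vund (h + 1) s'))
    -- the bonus dominates the one-step estimation error on `V*`
    (hbonus : ∀ h, 1 ≤ h → h ≤ H → ∀ s a,
      Rhat s a - Rbar s a + ∑ s', (Phat s a s' - P s a s') * Vstar (h + 1) s'
        ≤ b s a) :
    ∀ h, 1 ≤ h → h ≤ H + 1 → ∀ s, Vund h s ≤ Vstar h s := by
  intro h h1 hle
  suffices key : ∀ s, 0 ≤ Vstar h s ∧ Vund h s ≤ Vstar h s from fun s => (key s).2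
  induction hle using Nat.decreasingInduction with
  | self => simp [hVstarTop, hVundTop]
  | of_succ k hk ih =>
    have hkH : k ≤ H := Nat.lt_succ_iff.mp hk
    have ih := ih (Nat.le_add_left 1 k)
    have bellman_le (s : S) (a : A) :
        Rbar s a + ∑ s', P s a s' * Vstar (k + 1) s' ≤ Vstar k s := by
      rw [hVstarRec k h1 hkH s]
      exact Finset.le_sup' (fun a => Rbar s a + ∑ s', P s a s' * Vstar (k + 1) s')
        (Finset.mem_univ a)
    intro s
    have hnonneg : 0 ≤ Vstar k s :=
      (add_nonneg (hR s (π k s)).1 (Finset.sum_nonneg fun s' _ =>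
        mul_nonneg ((hP s (π k s)).1 s') (ih s').1)).trans (bellman_le s (π k s))
    refine ⟨hnonneg, ?_⟩
    rw [hVundRec k h1 hkH s]
    refine max_le hnonneg ?_
    have hmono : ∑ s', Phat s (π k s) s' * Vund (k + 1) s'
        ≤ ∑ s', Phat s (π k s) s' * Vstar (k + 1) s' :=
      Finset.sum_le_sum fun s' _ =>
        mul_le_mul_of_nonneg_left (ih s').2 ((hPhat s (π k s)).1 s')
    have herr := hbonus k h1 hkH s (π k s)
    simp only [sub_mul, Finset.sum_sub_distrib] at herr
    linarith [bellman_le s (π k s)]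
end

section
/- (Bounding the optimistic–pessimistic gap by the expected sum of bonuses along the true dynamics; deterministic core of the lemma connecting V̄ − V_ with the confidence bonuses.) Let π = (π_1,…,π_H) with π_h : 𝒮 → 𝒜 be a deterministic policy, let P̂(·|s,a) be a pmf on 𝒮 for each (s,a), and let g : 𝒮 × 𝒜 → [0,∞). Suppose functions V̄_h, V__h : 𝒮 → ℝ for h ∈ {1,…,H+1} satisfy: V̄_{H+1} = V__{H+1} ≡ 0; 0 ≤ V̄_h(s) − V__h(s) ≤ H for all h and s; and V̄_h(s) − V__h(s) ≤ g(s,π_h(s)) + Σ_{s'} P̂(s'|s,π_h(s)) ( V̄_{h+1}(s') − V__{h+1}(s') ) for all h ∈ {1,…,H} and s ∈ 𝒮. Define F_{H+1} ≡ 0 and F_h(s) = g(s,π_h(s)) + H · ‖P̂(·|s,π_h(s)) − P(·|s,π_h(s))‖₁ + Σ_{s'} P(s'|s,π_h(s)) F_{h+1}(s') (so F_h(s) is the expected value, under the true dynamics P with policy π started from s_h = s, of the sum over steps t = h,…,H of g(s_t,π_t(s_t)) + H‖P̂(·|s_t,π_t(s_t)) − P(·|s_t,π_t(s_t))‖₁).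 Then V̄_h(s) − V__h(s) ≤ F_h(s) for all h ∈ {1,…,H+1} and all s ∈ 𝒮. -/
open Finset

/-- Changing the weights of a sum of values bounded by `B` costs at most `B` times the
L1 distance of the weights. -/
theorem sum_mul_le_mul_sum_abs_sub_add {X : Type*} [Fintype X] (p q f : X → ℝ) (B : ℝ)
    (hf : ∀ x, |f x| ≤ B) :
    ∑ x, p x * f x ≤ B * ∑ x, |p x - q x| + ∑ x, q x * f x := by
  rw [Finset.mul_sum, ← Finset.sum_add_distrib]
  refine Finset.sum_le_sum fun x _ => ?_
  have h : (p x - q x) * f x ≤ |p x - q x| * B :=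
    (le_abs_self _).trans ((abs_mul _ _).trans_le
      (mul_le_mul_of_nonneg_left (hf x) (abs_nonneg _)))
  linarith

/-- **Bounding the optimistic–pessimistic gap by the expected sum of bonuses
along the true dynamics** (deterministic core of the lemma connecting
`V̄ − V_` with the confidence bonuses). -/
theorem gap_bounded_by_expected_bonuses
    (S A : Type) [Fintype S] [Nonempty S] [Fintype A] [Nonempty A]
    (H : ℕ) (hH : 1 ≤ H)
    (Rbar : S → A → ℝ) (hR : ∀ s a, 0 ≤ Rbar s a ∧ Rbar s a ≤ 1)
    (P : S → A → S → ℝ) (hP : ∀ s a, IsPmf (P s a))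
    -- a deterministic policy, an estimated transition model, a bonus-like function
    (π : ℕ → S → A)
    (Phat : S → A → S → ℝ) (hPhat : ∀ s a, IsPmf (Phat s a))
    (g : S → A → ℝ) (hg : ∀ s a, 0 ≤ g s a)
    -- optimistic and pessimistic value estimates
    (Vbar Vund : ℕ → S → ℝ)
    (hVbarTop : ∀ s, Vbar (H + 1) s = 0)
    (hVundTop : ∀ s, Vund (H + 1) s = 0)
    (hgap : ∀ h, 1 ≤ h → h ≤ H + 1 → ∀ s,
      0 ≤ Vbar h s - Vund h s ∧ Vbar h s - Vund h s ≤ (H : ℝ))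
    (hrec : ∀ h, 1 ≤ h → h ≤ H → ∀ s,
      Vbar h s - Vund h s
        ≤ g s (π h s)
          + ∑ s', Phat s (π h s) s' * (Vbar (h + 1) s' - Vund (h + 1) s'))
    -- expected sum of bonuses along the true dynamics
    (F : ℕ → S → ℝ)
    (hFTop : ∀ s, F (H + 1) s = 0)
    (hFrec : ∀ h, 1 ≤ h → h ≤ H → ∀ s,
      F h s = g s (π h s)
        + (H : ℝ) * (∑ s', |Phat s (π h s) s' - P s (π h s) s'|)
        + ∑ s', P s (π h s) s' * F (h + 1) s') :
    ∀ h, 1 ≤ h → h ≤ H + 1 → ∀ s, Vbar h s - Vund h s ≤ F h s := by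
  intro h h1 hle
  induction hle using Nat.decreasingInduction with
  | self => intro s; simp [hVbarTop, hVundTop, hFTop]
  | of_succ k hk ih =>
    intro s
    have hchange := sum_mul_le_mul_sum_abs_sub_add (Phat s (π k s)) (P s (π k s))
      (fun s' => Vbar (k + 1) s' - Vund (k + 1) s') H fun s' => by
        obtain ⟨hnonneg, hub⟩ := hgap (k + 1) (by omega) (by omega) s'
        rwa [abs_of_nonneg hnonneg]
    have hmono : ∑ s', P s (π k s) s' * (Vbar (k + 1) s' - Vund (k + 1) s')
        ≤ ∑ s', P s (π k s) s' * F (k + 1) s' :=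
      Finset.sum_le_sum fun s' _ =>
        mul_le_mul_of_nonneg_left (ih (by omega) s') ((hP s (π k s)).1 s')
    rw [hFrec k h1 (by omega) s]
    linarith [hrec k h1 (by omega) s]
end
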